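/- arXiv:1709.05985 — 2 statements merged into one kernel-verified Lean document; each statement's English description precedes it below -/
import Mathlib

section
/- Let k be an infinite field and let d ≥ 2. For general forms f₁, f₂, f₃ of degree d in R = k[x,y], setting I = (f₁, f₂, f₃), the Hilbert function of I satisfies H(I,t) = 3·H(R, t−d) − H(R, t−d−⌊d/2⌋) − H(R, t−d−⌈d/2⌉) for all integers t, where H(M, t) denotes the k-dimension of the degree-t graded piece of M and H(R, t) = t+1 for t ≥ 0 and 0 for t < 0. -/
open MvPolynomial

noncomputable section

/-- The binary form of degree `d` in `k[x,y]` with coefficient vector `c`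
(`x := X 0`, `y := X 1`). -/
def formOf {k : Type*} [Field k] (d : ℕ) (c : Fin (d + 1) → k) :
    MvPolynomial (Fin 2) k :=
  ∑ l : Fin (d + 1), C (c l) * X 0 ^ (l : ℕ) * X 1 ^ (d - (l : ℕ))

/-- The degree-`t` graded piece of an ideal `I ⊆ k[x,y]`, as a `k`-vector space. -/
def idealPiece {k : Type*} [Field k] (I : Ideal (MvPolynomial (Fin 2) k)) (t : ℕ) :
    Submodule k (MvPolynomial (Fin 2) k) :=
  Submodule.restrictScalars k I ⊓ homogeneousSubmodule (Fin 2) k t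

/-- The Hilbert function of `R = k[x,y]`: `H(R,t) = t + 1` for `t ≥ 0` and `0` for `t < 0`. -/
def HR (t : ℤ) : ℤ := if 0 ≤ t then t + 1 else 0

/-- Linear families of endomorphisms are bijective on a principal open subset of the parameter
space. -/
lemma exists_eval_ne_zero_iff_injective {k σ V : Type*} [Field k] [Fintype σ] [AddCommGroup V]
    [Module k V] [FiniteDimensional k V] (B : (σ → k) →ₗ[k] Module.End k V) :
    ∃ P : MvPolynomial σ k, ∀ c, eval c P ≠ 0 ↔ Function.Injective (B c) := by
  classical
  refine ⟨(B.polyCharpoly (Pi.basisFun k σ)).coeff 0, fun c => ?_⟩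
  have h := B.polyCharpoly_coeff_eval (Pi.basisFun k σ) c 0
  have hc : ⇑((Pi.basisFun k σ).repr c) = c := by ext; simp
  rw [hc] at h
  rw [h, ← Polynomial.constantCoeff_apply, ne_eq, LinearMap.charpoly_constantCoeff_eq_zero_iff,
    injective_iff_map_eq_zero]
  push Not
  exact forall_congr' fun m => not_imp_not

/-- In a linear family of linear maps, injectivity is an open condition. -/
lemma exists_eval_ne_zero_imp_injective {k σ V W : Type*} [Field k] [Fintype σ]
    [AddCommGroup V] [Module k V] [FiniteDimensional k V] [AddCommGroup W] [Module k W]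
    (A : (σ → k) →ₗ[k] V →ₗ[k] W) (c₀ : σ → k) (h₀ : Function.Injective (A c₀)) :
    ∃ P : MvPolynomial σ k, eval c₀ P ≠ 0 ∧ ∀ c, eval c P ≠ 0 → Function.Injective (A c) := by
  obtain ⟨L, hL⟩ := (A c₀).exists_leftInverse_of_injective (LinearMap.ker_eq_bot.2 h₀)
  obtain ⟨P, hP⟩ := exists_eval_ne_zero_iff_injective (LinearMap.compRight k L ∘ₗ A)
  refine ⟨P, (hP c₀).2 ?_, fun c hc => ?_⟩
  · have : (LinearMap.compRight k L ∘ₗ A) c₀ = LinearMap.id := hL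
    rw [this]
    exact Function.injective_id
  · exact Function.Injective.of_comp (f := L) ((hP c).1 hc)

/-- In a linear family of linear maps, surjectivity is an open condition. -/
lemma exists_eval_ne_zero_imp_surjective {k σ V W : Type*} [Field k] [Fintype σ]
    [AddCommGroup V] [Module k V] [AddCommGroup W] [Module k W] [FiniteDimensional k W]
    (A : (σ → k) →ₗ[k] V →ₗ[k] W) (c₀ : σ → k) (h₀ : Function.Surjective (A c₀)) :
    ∃ P : MvPolynomial σ k, eval c₀ P ≠ 0 ∧ ∀ c, eval c P ≠ 0 → Function.Surjective (A c) := by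
  obtain ⟨L, hL⟩ := (A c₀).exists_rightInverse_of_surjective (LinearMap.range_eq_top.2 h₀)
  obtain ⟨P, hP⟩ := exists_eval_ne_zero_iff_injective (LinearMap.lcomp k W L ∘ₗ A)
  refine ⟨P, (hP c₀).2 ?_, fun c hc => ?_⟩
  · have : (LinearMap.lcomp k W L ∘ₗ A) c₀ = LinearMap.id := hL
    rw [this]
    exact Function.injective_id
  · exact Function.Surjective.of_comp (g := L)
      (LinearMap.surjective_of_injective ((hP c).1 hc))

section BinaryForms

variable {k : Type*} [Field k]

instance finiteDimensional_homogeneousSubmodule (n : ℕ) :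
    FiniteDimensional k (homogeneousSubmodule (Fin 2) k n) :=
  Module.Finite.iff_fg.2 (homogeneousSubmodule_fg (Fin 2) k n)

/-- Exponent vectors of binary monomials of degree `n`. -/
def binaryExponentEquiv (n : ℕ) : {m : Fin 2 →₀ ℕ | m.degree = n} ≃ Fin (n + 1) where
  toFun m := ⟨m.1 0, by
    have := m.2
    simp only [Set.mem_ofPred_eq, Finsupp.degree_eq_sum, Fin.sum_univ_two] at this
    omega⟩
  invFun i := ⟨Finsupp.equivFunOnFinite.symm ![i, n - i], by
    simp only [Set.mem_ofPred_eq, Finsupp.degree_eq_sum, Fin.sum_univ_two]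
    simp
    omega⟩
  left_inv m := by
    have := m.2
    simp only [Set.mem_ofPred_eq, Finsupp.degree_eq_sum, Fin.sum_univ_two] at this
    ext i
    fin_cases i
    · simp
    · simp
      omega
  right_inv i := by simp

lemma finrank_homogeneousSubmodule_fin_two (n : ℕ) :
    Module.finrank k (homogeneousSubmodule (Fin 2) k n) = n + 1 := by
  rw [homogeneousSubmodule_eq_finsupp_supported,
    ((AddMonoidAlgebra.supportedEquivFinsupp _).trans
      (Finsupp.domLCongr (binaryExponentEquiv n))).finrank_eq]
  simp

lemma formOf_add (d : ℕ) (a b : Fin (d + 1) → k) : formOf d (a + b) = formOf d a + formOf d b := by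
  simp [formOf, add_mul, Finset.sum_add_distrib]

lemma formOf_smul (d : ℕ) (r : k) (a : Fin (d + 1) → k) :
    formOf d (r • a) = r • formOf d a := by
  simp [formOf, MvPolynomial.smul_eq_C_mul, Finset.mul_sum, mul_assoc]

lemma formOf_mem_homogeneousSubmodule (d : ℕ) (a : Fin (d + 1) → k) :
    formOf d a ∈ homogeneousSubmodule (Fin 2) k d := by
  refine Submodule.sum_mem _ fun l _ => ?_
  have h := ((isHomogeneous_C_mul_X_pow (a l) (0 : Fin 2) (l : ℕ)).mul
    (isHomogeneous_X_pow (R := k) (1 : Fin 2) (d - (l : ℕ))))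
  rwa [Nat.add_sub_cancel' (Nat.lt_succ_iff.1 l.2)] at h

/-- The exponent vector of `x ^ a * y ^ b`. -/
def binaryExponent (a b : ℕ) : Fin 2 →₀ ℕ := Finsupp.single 0 a + Finsupp.single 1 b

@[simp] lemma binaryExponent_zero (a b : ℕ) : binaryExponent a b 0 = a := by
  simp [binaryExponent]

@[simp] lemma binaryExponent_one (a b : ℕ) : binaryExponent a b 1 = b := by
  simp [binaryExponent]

lemma formOf_single (d : ℕ) (l : Fin (d + 1)) :
    formOf d (Pi.single l (1 : k)) = monomial (binaryExponent l (d - l)) 1 := by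
  rw [formOf, Finset.sum_eq_single l]
  · simp [binaryExponent, X_pow_eq_monomial, monomial_mul]
  · intro j _ hj
    simp [hj]
  · simp

/-- The map `(g₁, g₂, g₃) ↦ g₁ f₁ + g₂ f₂ + g₃ f₃` on triples of forms of degree `s`, as a linear
function of the coefficients of the forms `fᵢ` of degree `d`. -/
def formCombination (d s : ℕ) :
    (Fin 3 × Fin (d + 1) → k) →ₗ[k] (Fin 3 → homogeneousSubmodule (Fin 2) k s) →ₗ[k]
      homogeneousSubmodule (Fin 2) k (s + d) :=
  LinearMap.mk₂ k
    (fun c g => ⟨∑ i, (g i : MvPolynomial (Fin 2) k) * formOf d (fun l => c (i, l)),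
      Submodule.sum_mem _ fun i _ =>
        IsHomogeneous.mul (g i).2 (formOf_mem_homogeneousSubmodule d _)⟩)
    (fun c c' g => Subtype.ext <| by
      have (i : Fin 3) := formOf_add d (fun l => c (i, l)) (fun l => c' (i, l))
      simp only [Pi.add_def] at this
      simp [this, mul_add, Finset.sum_add_distrib])
    (fun r c g => Subtype.ext <| by
      have (i : Fin 3) := formOf_smul d r (fun l => c (i, l))
      simp only [Pi.smul_def, smul_eq_mul] at this
      simp [this, Finset.smul_sum])
    (fun c g g' => Subtype.ext <| by simp [add_mul, Finset.sum_add_distrib])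
    (fun r c g => Subtype.ext <| by simp [Finset.smul_sum])

lemma coe_formCombination (d s : ℕ) (c : Fin 3 × Fin (d + 1) → k)
    (g : Fin 3 → homogeneousSubmodule (Fin 2) k s) :
    (formCombination d s c g : MvPolynomial (Fin 2) k) =
      ∑ i, (g i : MvPolynomial (Fin 2) k) * formOf d (fun l => c (i, l)) := rfl

lemma formCombination_injective_of_le {d s s' : ℕ} (hs : s ≤ s') {c : Fin 3 × Fin (d + 1) → k}
    (h : Function.Injective (formCombination d s' c)) :
    Function.Injective (formCombination d s c) := by
  rw [injective_iff_map_eq_zero] at h ⊢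
  intro g hg
  have hg' := h (fun i => ⟨X 0 ^ (s' - s) * (g i : MvPolynomial (Fin 2) k), by
    have := (isHomogeneous_X_pow (R := k) (0 : Fin 2) (s' - s)).mul (g i).2
    rwa [Nat.sub_add_cancel hs] at this⟩) (Subtype.ext <| by
      have := congrArg Subtype.val hg
      rw [coe_formCombination] at this ⊢
      simp only [mul_assoc]
      rw [← Finset.mul_sum, this]
      simp)
  funext i
  have := congrArg Subtype.val (congrFun hg' i)
  simpa using this

/-- Exponents of the monomials `x ^ d`, `y ^ d`, `x ^ ⌊d/2⌋ y ^ ⌈d/2⌉`, indexed by the power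
of `x`. -/
def monomialTriple (d : ℕ) : Fin 3 → Fin (d + 1) :=
  ![Fin.last d, 0, ⟨d / 2, by omega⟩]

/-- The coefficients of `x ^ d`, `y ^ d`, `x ^ ⌊d/2⌋ y ^ ⌈d/2⌉`. -/
def monomialCoeffs (k : Type*) [Field k] (d : ℕ) : Fin 3 × Fin (d + 1) → k :=
  fun p => (Pi.single (monomialTriple d p.1) (1 : k) : Fin (d + 1) → k) p.2

lemma coe_formCombination_monomialCoeffs (d s : ℕ)
    (g : Fin 3 → homogeneousSubmodule (Fin 2) k s) :
    (formCombination d s (monomialCoeffs k d) g : MvPolynomial (Fin 2) k) =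
      ∑ i, (g i : MvPolynomial (Fin 2) k) *
        monomial (binaryExponent (monomialTriple d i) (d - monomialTriple d i)) 1 := by
  rw [coe_formCombination]
  refine Finset.sum_congr rfl fun i _ => ?_
  rw [← formOf_single]
  rfl

lemma formCombination_monomialCoeffs_injective (d : ℕ) (hd : 2 ≤ d) :
    Function.Injective (formCombination d (d / 2 - 1) (monomialCoeffs k d)) := by
  rw [injective_iff_map_eq_zero]
  intro g hg
  have hg' := congrArg Subtype.val hg
  rw [coe_formCombination_monomialCoeffs] at hg'
  funext i
  ext m
  by_cases hm : m.degree = d / 2 - 1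
  swap
  · simpa using IsHomogeneous.coeff_eq_zero (g i).2 hm
  rw [Finsupp.degree_eq_sum, Fin.sum_univ_two] at hm
  have h := congrArg
    (coeff (m + binaryExponent (monomialTriple d i) (d - monomialTriple d i))) hg'
  rw [coeff_sum, Finset.sum_eq_single i] at h
  · simpa [coeff_mul_monomial] using h
  · intro j _ hj
    rw [coeff_mul_monomial', if_neg]
    intro hle
    have h0 := hle 0
    have h1 := hle 1
    simp only [Finsupp.add_apply, binaryExponent_zero, binaryExponent_one] at h0 h1
    fin_cases i <;> fin_cases j <;> simp [monomialTriple] at h0 h1 hj <;> omega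
  · simp

lemma formCombination_monomialCoeffs_surjective (d : ℕ) :
    Function.Surjective (formCombination d (d / 2) (monomialCoeffs k d)) := by
  suffices h : homogeneousSubmodule (Fin 2) k (d / 2 + d) ≤
      (LinearMap.range (formCombination d (d / 2) (monomialCoeffs k d))).map
        (Submodule.subtype _) by
    intro w
    obtain ⟨w', ⟨g, hg⟩, hw⟩ := h w.2
    exact ⟨g, hg.trans (Subtype.ext hw)⟩
  conv_lhs => rw [homogeneousSubmodule_eq_finsupp_supported,
    AddMonoidAlgebra.supported_eq_span_single]
  rw [Submodule.span_le]
  rintro _ ⟨m, hm, rfl⟩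
  rw [Set.mem_ofPred_eq, Finsupp.degree_eq_sum, Fin.sum_univ_two] at hm
  obtain ⟨i, h0, h1⟩ :
      ∃ i, (monomialTriple d i : ℕ) ≤ m 0 ∧ d - (monomialTriple d i : ℕ) ≤ m 1 := by
    by_cases h0 : d ≤ m 0
    · exact ⟨0, by simpa [monomialTriple] using h0⟩
    by_cases h1 : d ≤ m 1
    · exact ⟨1, by simpa [monomialTriple] using h1⟩
    refine ⟨2, ?_⟩
    simp [monomialTriple]
    omega
  set u := binaryExponent (monomialTriple d i) (d - monomialTriple d i) with hu
  have hle : u ≤ m := by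
    intro j
    fin_cases j
    · simpa [hu] using h0
    · simpa [hu] using h1
  have hdeg : (m - u).degree = d / 2 := by
    have := (monomialTriple d i).2
    rw [Finsupp.degree_eq_sum, Fin.sum_univ_two]
    simp [hu]
    omega
  refine ⟨_, ⟨Pi.single i ⟨monomial (m - u) 1, isHomogeneous_monomial 1 hdeg⟩, rfl⟩, ?_⟩
  rw [Submodule.subtype_apply, coe_formCombination_monomialCoeffs, Finset.sum_eq_single i]
  · rw [Pi.single_eq_same, ← hu, monomial_mul, tsub_add_cancel_of_le hle, mul_one]
    rfl
  · intro j _ hj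
    simp [hj]
  · simp

attribute [local instance] MvPolynomial.gradedAlgebra in
lemma idealPiece_eq_bot (d : ℕ) (c : Fin 3 × Fin (d + 1) → k) {t : ℕ} (ht : t < d) :
    idealPiece (Ideal.span (Set.range fun i => formOf d (fun l => c (i, l)))) t = ⊥ := by
  rw [eq_bot_iff]
  rintro p ⟨hp, hpt⟩
  obtain ⟨a, rfl⟩ := Ideal.mem_span_range_iff_exists_fun.1 hp
  rw [Submodule.mem_bot, ← DirectSum.decompose_of_mem_same _ hpt, DirectSum.decompose_sum,
    DFinsupp.finsetSum_apply, Submodule.coe_sum]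
  exact Finset.sum_eq_zero fun i _ => DirectSum.coe_decompose_mul_of_right_mem_of_not_le _
    (formOf_mem_homogeneousSubmodule d _) ht.not_ge

attribute [local instance] MvPolynomial.gradedAlgebra in
lemma idealPiece_eq_map_range_formCombination (d s : ℕ) (c : Fin 3 × Fin (d + 1) → k) :
    idealPiece (Ideal.span (Set.range fun i => formOf d (fun l => c (i, l)))) (s + d) =
      (LinearMap.range (formCombination d s c)).map (Submodule.subtype _) := by
  refine le_antisymm ?_ ?_
  · rintro p ⟨hp, hpt⟩
    obtain ⟨a, rfl⟩ := Ideal.mem_span_range_iff_exists_fun.1 hp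
    refine ⟨_, ⟨fun i => DirectSum.decompose (homogeneousSubmodule (Fin 2) k) (a i) s, rfl⟩, ?_⟩
    rw [Submodule.subtype_apply, coe_formCombination]
    conv_rhs => rw [← DirectSum.decompose_of_mem_same _ hpt, DirectSum.decompose_sum,
      DFinsupp.finsetSum_apply, Submodule.coe_sum]
    refine Finset.sum_congr rfl fun i _ => ?_
    rw [DirectSum.coe_decompose_mul_of_right_mem_of_le _
      (formOf_mem_homogeneousSubmodule d _) (Nat.le_add_left d s), Nat.add_sub_cancel]
  · rintro _ ⟨_, ⟨g, rfl⟩, rfl⟩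
    exact ⟨Ideal.mem_span_range_iff_exists_fun.2 ⟨fun i => g i, rfl⟩, (formCombination d s c g).2⟩

/-- An ideal containing all binary forms of degree `n` contains all those of larger degree. -/
lemma idealPiece_eq_homogeneousSubmodule_of_le {I : Ideal (MvPolynomial (Fin 2) k)} {n t : ℕ}
    (hI : idealPiece I n = homogeneousSubmodule (Fin 2) k n) (ht : n ≤ t) :
    idealPiece I t = homogeneousSubmodule (Fin 2) k t := by
  refine le_antisymm inf_le_right (le_inf ?_ le_rfl)
  rw [homogeneousSubmodule_eq_finsupp_supported, AddMonoidAlgebra.supported_eq_span_single,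
    Submodule.span_le]
  rintro _ ⟨m, hm, rfl⟩
  rw [Set.mem_ofPred_eq, Finsupp.degree_eq_sum, Fin.sum_univ_two] at hm
  set u := binaryExponent (min (m 0) n) (n - min (m 0) n) with hu
  have hle : u ≤ m := by
    intro j
    fin_cases j <;> simp [hu]
    omega
  have hdeg : u.degree = n := by
    rw [Finsupp.degree_eq_sum, Fin.sum_univ_two]
    simp [hu]
  have hmem : monomial u (1 : k) ∈ idealPiece I n := hI ▸ isHomogeneous_monomial 1 hdeg
  have := I.mul_mem_left (monomial (m - u) 1) hmem.1
  rwa [monomial_mul, tsub_add_cancel_of_le hle, mul_one] at this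

end BinaryForms

/-- For an infinite field `k` and `d ≥ 2`, for general forms `f₁, f₂, f₃` of degree `d`
in `R = k[x,y]` (genericity encoded as the nonvanishing locus of a nonzero polynomial
on the parameter space `k^{3(d+1)}`), with `I = (f₁,f₂,f₃)`, the Hilbert function of `I`
satisfies `H(I,t) = 3·H(R,t−d) − H(R,t−d−⌊d/2⌋) − H(R,t−d−⌈d/2⌉)` for all `t`. -/
theorem general_binary_forms_hilbert_function (k : Type*) [Field k] [Infinite k]
    (d : ℕ) (hd : 2 ≤ d) :
    ∃ P : MvPolynomial (Fin 3 × Fin (d + 1)) k, P ≠ 0 ∧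
      ∀ c : Fin 3 → Fin (d + 1) → k,
        eval (fun p => c p.1 p.2) P ≠ 0 →
          ∀ t : ℕ,
            (Module.finrank k
              (idealPiece (Ideal.span {formOf d (c 0), formOf d (c 1), formOf d (c 2)}) t) : ℤ) =
            3 * HR ((t : ℤ) - d) - HR ((t : ℤ) - d - (d / 2 : ℕ))
              - HR ((t : ℤ) - d - ((d + 1) / 2 : ℕ)) := by
  obtain ⟨P, hP₀, hP⟩ := exists_eval_ne_zero_imp_injective _ _
    (formCombination_monomialCoeffs_injective (k := k) d hd)
  obtain ⟨Q, hQ₀, hQ⟩ := exists_eval_ne_zero_imp_surjective _ _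
    (formCombination_monomialCoeffs_surjective (k := k) d)
  refine ⟨P * Q, fun h => ?_, fun c hc t => ?_⟩
  · have := congrArg (eval (monomialCoeffs k d)) h
    rw [map_mul, map_zero] at this
    exact mul_ne_zero hP₀ hQ₀ this
  obtain ⟨c', hc'⟩ : ∃ c' : Fin 3 × Fin (d + 1) → k, c' = fun p => c p.1 p.2 := ⟨_, rfl⟩
  rw [map_mul, ← hc'] at hc
  have hinj := hP _ (left_ne_zero_of_mul hc)
  have hsurj := hQ _ (right_ne_zero_of_mul hc)
  have hset : ({formOf d (c 0), formOf d (c 1), formOf d (c 2)} : Set (MvPolynomial (Fin 2) k)) =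
      Set.range fun i => formOf d (fun l => c' (i, l)) := by
    ext p
    simp [hc', Fin.exists_fin_succ, eq_comm]
  rw [hset]
  rcases lt_or_ge t d with htd | htd
  · rw [idealPiece_eq_bot d _ htd]
    simp only [finrank_bot, HR]
    split_ifs <;> omega
  obtain ⟨s, rfl⟩ := Nat.exists_eq_add_of_le' htd
  rcases lt_or_ge s (d / 2) with hs | hs
  · rw [idealPiece_eq_map_range_formCombination, Submodule.finrank_map_subtype_eq,
      LinearMap.finrank_range_of_inj (formCombination_injective_of_le (by omega) hinj)]
    simp only [Module.finrank_pi_fintype, finrank_homogeneousSubmodule_fin_two,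
      Fin.sum_univ_three, HR]
    split_ifs <;> omega
  · rw [idealPiece_eq_homogeneousSubmodule_of_le (n := d / 2 + d) _ (by omega),
      finrank_homogeneousSubmodule_fin_two]
    · simp only [HR]
      split_ifs <;> omega
    · rw [idealPiece_eq_map_range_formCombination, LinearMap.range_eq_top.2 hsurj,
        Submodule.map_subtype_top]
end
end

section
/- Let k be an infinite field and let d = 2s+1 be odd with d ≥ 2. For general forms f₁, f₂, f₃ of degree d in R = k[x,y], setting I = (f₁, f₂, f₃), the monomial y^{3s} does not belong to I; consequently its residue class spans the one-dimensional k-vector space (R/I)_{3s}. -/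
open MvPolynomial

noncomputable section

/-- The degree-`j` graded piece of `R/I`, `R = k[x,y]`: the image of the homogeneous
polynomials of degree `j` in the quotient, as a `k`-vector space. -/
def quotPiece {k : Type*} [Field k] (I : Ideal (MvPolynomial (Fin 2) k)) (j : ℕ) :
    Submodule k (MvPolynomial (Fin 2) k ⧸ I) :=
  Submodule.map (Ideal.Quotient.mkₐ k I).toLinearMap (homogeneousSubmodule (Fin 2) k j)

/-- The exponent vector of the monomial `x ^ a * y ^ b`. -/
def expVec (a b : ℕ) : Fin 2 →₀ ℕ := Finsupp.single 0 a + Finsupp.single 1 b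

@[simp] lemma expVec_zero (a b : ℕ) : expVec a b 0 = a := by simp [expVec]

@[simp] lemma expVec_one (a b : ℕ) : expVec a b 1 = b := by simp [expVec]

lemma expVec_ext_iff {m m' : Fin 2 →₀ ℕ} : m = m' ↔ m 0 = m' 0 ∧ m 1 = m' 1 := by
  rw [Finsupp.ext_iff, Fin.forall_fin_two]

lemma expVec_eq_self (m : Fin 2 →₀ ℕ) : expVec (m 0) (m 1) = m := by
  simp [expVec_ext_iff]

lemma degree_expVec (a b : ℕ) : (expVec a b).degree = a + b := by
  simp [expVec]

lemma formOf_eq_sum_monomial {k : Type*} [Field k] (d : ℕ) (c : Fin (d + 1) → k) :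
    formOf d c = ∑ l : Fin (d + 1), monomial (expVec l (d - l)) (c l) := by
  refine Finset.sum_congr rfl fun l _ => ?_
  rw [X_pow_eq_monomial, X_pow_eq_monomial, C_mul_monomial, monomial_mul, expVec]
  simp

lemma isHomogeneous_formOf {k : Type*} [Field k] (d : ℕ) (c : Fin (d + 1) → k) :
    (formOf d c).IsHomogeneous d := by
  rw [formOf_eq_sum_monomial]
  refine IsHomogeneous.sum _ _ _ fun l _ => isHomogeneous_monomial _ ?_
  rw [degree_expVec]
  omega

lemma coeff_formOf_mul_monomial {k : Type*} [Field k] {d a b n m : ℕ}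
    (c : Fin (d + 1) → k) (h : n + m = d + (a + b)) :
    coeff (expVec n m) (formOf d c * monomial (expVec a b) 1) =
      ∑ l : Fin (d + 1), if (l : ℕ) + a = n then c l else 0 := by
  rw [formOf_eq_sum_monomial, Finset.sum_mul, coeff_sum]
  refine Finset.sum_congr rfl fun l _ => ?_
  rw [monomial_mul, coeff_monomial, mul_one]
  refine if_congr ?_ rfl rfl
  simp only [expVec_ext_iff, Finsupp.add_apply, expVec_zero, expVec_one]
  omega

/-- The `x`-exponents `0, …, 3s`, indexed by `Option (Fin 3 × Fin s)`. -/
def xExp (s : ℕ) : Option (Fin 3 × Fin s) → ℕ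
  | none => 0
  | some (i, a) => 1 + i * s + a

lemma xExp_le (s : ℕ) (r : Option (Fin 3 × Fin s)) : xExp s r ≤ 3 * s := by
  rcases r with _ | ⟨i, a⟩
  · simp [xExp]
  · have := a.2
    fin_cases i <;> simp [xExp] <;> omega

lemma xExp_injective (s : ℕ) : Function.Injective (xExp s) := by
  rintro (_ | ⟨i, a⟩) (_ | ⟨j, b⟩) h
  · rfl
  · simp [xExp] at h; omega
  · simp [xExp] at h
  · have ha := a.2
    have hb := b.2
    fin_cases i <;> fin_cases j <;> simp [xExp, Fin.ext_iff] at h ⊢ <;> omega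

lemma exists_xExp_eq {s n : ℕ} (hn : n ≤ 3 * s) : ∃ r, xExp s r = n := by
  obtain _ | n := n
  · exact ⟨none, rfl⟩
  · have hs : 0 < s := by omega
    refine ⟨some (⟨n / s, (Nat.div_lt_iff_lt_mul hs).2 (by omega)⟩,
      ⟨n % s, Nat.mod_lt _ hs⟩), ?_⟩
    have := Nat.div_add_mod' n s
    simp only [xExp]
    omega

/-- Coefficients, in degree `3s`, of `y ^ (3s)` and of the products of the three forms with
coefficient vectors `c i` by the monomials of degree `s - 1`. -/
def coeffMatrix {A : Type*} [CommRing A] (s : ℕ) (c : Fin 3 → Fin (2 * s + 1 + 1) → A) :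
    Matrix (Option (Fin 3 × Fin s)) (Option (Fin 3 × Fin s)) A
  | none, r => if r = none then 1 else 0
  | some (i, a), r => ∑ l : Fin (2 * s + 1 + 1), if (l : ℕ) + a = xExp s r then c i l else 0

lemma map_coeffMatrix {A B : Type*} [CommRing A] [CommRing B] (f : A →+* B) (s : ℕ)
    (c : Fin 3 → Fin (2 * s + 1 + 1) → A) :
    f.mapMatrix (coeffMatrix s c) = coeffMatrix s (fun i l => f (c i l)) := by
  ext q r
  rcases q with _ | ⟨i, a⟩ <;> simp [coeffMatrix, apply_ite f]

/-- For the monomials `x ^ (1 + i * s) * y ^ (2s - i * s)` the coefficient matrix is the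
identity. -/
lemma coeffMatrix_monomials (A : Type*) [CommRing A] (s : ℕ) :
    coeffMatrix s (fun i l => if (l : ℕ) = 1 + i * s then (1 : A) else 0) = 1 := by
  ext q r
  rcases q with _ | ⟨i, a⟩
  · simp [coeffMatrix, Matrix.one_apply, eq_comm]
  · have hi : 1 + (i : ℕ) * s < 2 * s + 1 + 1 := by fin_cases i <;> simp <;> omega
    rw [coeffMatrix, Finset.sum_eq_single ⟨1 + i * s, hi⟩]
    · rw [Matrix.one_apply, if_pos rfl]
      change (if xExp s (some (i, a)) = xExp s r then (1 : A) else 0) = _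
      exact if_congr (xExp_injective s).eq_iff rfl rfl
    · intro l _ hl
      rw [if_neg (fun h => hl (Fin.ext h)), ite_self]
    · simp

/-- The monomial `y ^ (3s)` and the products of the three forms with coefficient vectors `c i`
by the monomials of degree `s - 1`. -/
def spanningForm {k : Type*} [Field k] (s : ℕ) (c : Fin 3 → Fin (2 * s + 1 + 1) → k) :
    Option (Fin 3 × Fin s) → MvPolynomial (Fin 2) k
  | none => X 1 ^ (3 * s)
  | some (i, a) => formOf (2 * s + 1) (c i) * monomial (expVec a (s - 1 - a)) 1

/-- The coefficients of the monomials of degree `3s`. -/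
def coeffVec (k : Type*) [Field k] (s : ℕ) :
    MvPolynomial (Fin 2) k →ₗ[k] (Option (Fin 3 × Fin s) → k) :=
  LinearMap.pi fun r => lcoeff k (expVec (xExp s r) (3 * s - xExp s r))

section

variable {k : Type*} [Field k] {s : ℕ}

lemma coeffVec_apply (g : MvPolynomial (Fin 2) k) (r : Option (Fin 3 × Fin s)) :
    coeffVec k s g r = coeff (expVec (xExp s r) (3 * s - xExp s r)) g := rfl

lemma eq_zero_of_coeffVec_eq_zero {g : MvPolynomial (Fin 2) k} (hg : g.IsHomogeneous (3 * s))
    (h : coeffVec k s g = 0) : g = 0 := by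
  ext m
  rw [coeff_zero]
  by_contra hm
  have hdeg : m 0 + m 1 = 3 * s := by
    by_contra hne
    refine hm (hg.coeff_eq_zero ?_)
    rwa [← expVec_eq_self m, degree_expVec]
  obtain ⟨r, hr⟩ := exists_xExp_eq (s := s) (n := m 0) (by omega)
  apply hm
  have := congrFun h r
  rwa [coeffVec_apply, hr, ← hdeg, Nat.add_sub_cancel_left, expVec_eq_self] at this

lemma coeffVec_eq_zero {g : MvPolynomial (Fin 2) k} {n : ℕ} (hg : g.IsHomogeneous n)
    (hn : n ≠ 3 * s) : coeffVec k s g = 0 := by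
  ext r
  refine hg.coeff_eq_zero ?_
  rw [degree_expVec]
  have := xExp_le s r
  omega

variable (c : Fin 3 → Fin (2 * s + 1 + 1) → k)

lemma isHomogeneous_spanningForm (q : Option (Fin 3 × Fin s)) :
    (spanningForm s c q).IsHomogeneous (3 * s) := by
  rcases q with _ | ⟨i, a⟩
  · exact isHomogeneous_X_pow _ _
  · have := a.2
    have h : 3 * s = (2 * s + 1) + (s - 1) := by omega
    rw [h]
    refine (isHomogeneous_formOf _ _).mul (isHomogeneous_monomial _ ?_)
    rw [degree_expVec]
    omega

lemma coeffVec_spanningForm (q : Option (Fin 3 × Fin s)) :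
    coeffVec k s (spanningForm s c q) = (coeffMatrix s c).row q := by
  ext r
  have hr := xExp_le s r
  rcases q with _ | ⟨i, a⟩
  · rw [coeffVec_apply, spanningForm, X_pow_eq_monomial, coeff_monomial, Matrix.row_apply, coeffMatrix]
    refine if_congr ?_ rfl rfl
    rw [← (xExp_injective s).eq_iff, expVec_ext_iff]
    simp [xExp]
    omega
  · have := a.2
    exact coeff_formOf_mul_monomial _ (by omega)

lemma spanningForm_some_mem {I : Ideal (MvPolynomial (Fin 2) k)}
    (hI : ∀ i, formOf (2 * s + 1) (c i) ∈ I) (p : Fin 3 × Fin s) :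
    spanningForm s c (some p) ∈ I :=
  I.mul_mem_right _ (hI p.1)

lemma coeffVec_formOf_mul_mem (i : Fin 3) (h : MvPolynomial (Fin 2) k) :
    coeffVec k s (formOf (2 * s + 1) (c i) * h) ∈
      Submodule.span k (Set.range fun p : Fin 3 × Fin s => (coeffMatrix s c).row (some p)) := by
  rw [h.as_sum, Finset.mul_sum, map_sum]
  refine Submodule.sum_mem _ fun m _ => ?_
  have hmon : monomial m (coeff m h) = coeff m h • monomial m 1 := by
    rw [smul_monomial, smul_eq_mul, mul_one]
  rw [hmon, mul_smul_comm, map_smul]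
  refine Submodule.smul_mem _ _ ?_
  by_cases hm : m 0 + m 1 + 1 = s
  · refine Submodule.subset_span ⟨(i, ⟨m 0, by omega⟩), ?_⟩
    have hm' : s - 1 - m 0 = m 1 := by omega
    simp only [← coeffVec_spanningForm, spanningForm, hm', expVec_eq_self]
  · rw [coeffVec_eq_zero ((isHomogeneous_formOf _ (c i)).mul
      (isHomogeneous_monomial 1 (n := m 0 + m 1) ?_)) (by omega)]
    · exact Submodule.zero_mem _
    · rw [← expVec_eq_self m, degree_expVec, expVec_zero, expVec_one]

lemma coeffVec_mem_span {g : MvPolynomial (Fin 2) k}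
    (hg : g ∈ Ideal.span (Set.range fun i => formOf (2 * s + 1) (c i))) :
    coeffVec k s g ∈
      Submodule.span k (Set.range fun p : Fin 3 × Fin s => (coeffMatrix s c).row (some p)) := by
  obtain ⟨h, rfl⟩ := Ideal.mem_span_range_iff_exists_fun.1 hg
  rw [map_sum]
  refine Submodule.sum_mem _ fun i _ => ?_
  rw [mul_comm]
  exact coeffVec_formOf_mul_mem c i (h i)

variable {c}

lemma X_pow_notMem_span (hdet : (coeffMatrix s c).det ≠ 0) :
    (X 1 ^ (3 * s) : MvPolynomial (Fin 2) k) ∉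
      Ideal.span (Set.range fun i => formOf (2 * s + 1) (c i)) := by
  intro hmem
  have hli : LinearIndependent k (coeffMatrix s c).row :=
    Matrix.linearIndependent_rows_of_det_ne_zero hdet
  refine (linearIndependent_option.1 hli).2 ?_
  rw [← coeffVec_spanningForm]
  exact coeffVec_mem_span c hmem

lemma exists_eq_sum_smul_spanningForm (hdet : (coeffMatrix s c).det ≠ 0)
    {g : MvPolynomial (Fin 2) k} (hg : g.IsHomogeneous (3 * s)) :
    ∃ w : Option (Fin 3 × Fin s) → k, g = ∑ q, w q • spanningForm s c q := by
  refine ⟨Matrix.vecMul (coeffVec k s g) (coeffMatrix s c)⁻¹, sub_eq_zero.1 ?_⟩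
  set w := Matrix.vecMul (coeffVec k s g) (coeffMatrix s c)⁻¹ with hw
  refine eq_zero_of_coeffVec_eq_zero (s := s) ?_ ?_
  · refine hg.sub (IsHomogeneous.sum _ _ _ fun q _ => ?_)
    exact (homogeneousSubmodule (Fin 2) k (3 * s)).smul_mem _ (isHomogeneous_spanningForm c q)
  · have h : Matrix.vecMul w (coeffMatrix s c) = coeffVec k s g := by
      rw [hw, Matrix.vecMul_vecMul, Matrix.nonsing_inv_mul _ (isUnit_iff_ne_zero.2 hdet),
        Matrix.vecMul_one]
    simp only [map_sub, map_sum, map_smul, coeffVec_spanningForm]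
    rw [← h, Matrix.vecMul_eq_sum]
    exact sub_self _

lemma span_mk_X_pow_eq_quotPiece (hdet : (coeffMatrix s c).det ≠ 0)
    {I : Ideal (MvPolynomial (Fin 2) k)} (hI : ∀ i, formOf (2 * s + 1) (c i) ∈ I) :
    Submodule.span k {Ideal.Quotient.mk I (X 1 ^ (3 * s))} = quotPiece I (3 * s) := by
  apply le_antisymm
  · rw [Submodule.span_singleton_le_iff_mem]
    exact ⟨_, isHomogeneous_X_pow _ _, rfl⟩
  · rintro _ ⟨g, hg, rfl⟩
    obtain ⟨w, hw⟩ := exists_eq_sum_smul_spanningForm hdet hg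
    refine Submodule.mem_span_singleton.2 ⟨w none, ?_⟩
    have hzero : ∀ p, Ideal.Quotient.mkₐ k I (spanningForm s c (some p)) = 0 := fun p =>
      Ideal.Quotient.eq_zero_iff_mem.2 (spanningForm_some_mem c hI p)
    rw [AlgHom.toLinearMap_apply, hw, Fintype.sum_option, map_add, map_sum, map_smul]
    simp only [map_smul, hzero, smul_zero, Finset.sum_const_zero, add_zero]
    rfl

end

/-- For an infinite field `k` and odd `d = 2s+1 ≥ 2`, for general forms `f₁, f₂, f₃` of
degree `d` in `R = k[x,y]` (genericity encoded as the nonvanishing locus of a nonzero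
polynomial on the parameter space `k^{3(d+1)}`), with `I = (f₁,f₂,f₃)`, the monomial
`y^{3s}` does not lie in `I`, and its residue class spans the one-dimensional
`k`-vector space `(R/I)_{3s}`. -/
theorem general_binary_forms_odd_monomial_spans (k : Type*) [Field k] [Infinite k]
    (s d : ℕ) (hs : 1 ≤ s) (hd : d = 2 * s + 1) :
    ∃ P : MvPolynomial (Fin 3 × Fin (d + 1)) k, P ≠ 0 ∧
      ∀ c : Fin 3 → Fin (d + 1) → k,
        eval (fun p => c p.1 p.2) P ≠ 0 →
          (X 1 ^ (3 * s) : MvPolynomial (Fin 2) k) ∉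
            Ideal.span {formOf d (c 0), formOf d (c 1), formOf d (c 2)} ∧
          Submodule.span k
              {Ideal.Quotient.mk (Ideal.span {formOf d (c 0), formOf d (c 1), formOf d (c 2)})
                (X 1 ^ (3 * s))} =
            quotPiece (Ideal.span {formOf d (c 0), formOf d (c 1), formOf d (c 2)}) (3 * s) ∧
          Module.finrank k
            (quotPiece (Ideal.span {formOf d (c 0), formOf d (c 1), formOf d (c 2)}) (3 * s)) =
              1 := by
  subst hd
  refine ⟨(coeffMatrix s fun i l => X (i, l)).det, fun h => ?_, fun c hc => ?_⟩
  · have := congrArg (eval fun p : Fin 3 × Fin (2 * s + 1 + 1) =>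
      if (p.2 : ℕ) = 1 + p.1 * s then (1 : k) else 0) h
    rw [RingHom.map_det, map_coeffMatrix] at this
    simp [coeffMatrix_monomials] at this
  · have hdet : (coeffMatrix s c).det ≠ 0 := by
      rw [RingHom.map_det, map_coeffMatrix] at hc
      simpa using hc
    have hset : ({formOf (2 * s + 1) (c 0), formOf (2 * s + 1) (c 1), formOf (2 * s + 1) (c 2)} :
        Set (MvPolynomial (Fin 2) k)) = Set.range fun i => formOf (2 * s + 1) (c i) := by
      ext g
      simp [Fin.exists_fin_succ, eq_comm]
    rw [hset]
    have hnot := X_pow_notMem_span hdet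
    have hspan := span_mk_X_pow_eq_quotPiece hdet fun i =>
      Ideal.subset_span (Set.mem_range_self (f := fun i => formOf (2 * s + 1) (c i)) i)
    refine ⟨hnot, hspan, ?_⟩
    rw [← hspan]
    exact finrank_span_singleton fun h => hnot (Ideal.Quotient.eq_zero_iff_mem.1 h)
end
end
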